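/- Every finite or infinite Restivo word avoids 4-powers; that is, any binary word of the form x_0 μ(x_1) μ²(x_2) ⋯ with each x_i ∈ S contains no nonempty factor of exponent ≥ 4 (equivalently, no factor of the form uuuu with u nonempty). -/

import Mathlib

/-- The Thue–Morse morphism μ : 0 ↦ 01, 1 ↦ 10 (false = 0, true = 1),
extended to finite binary words. -/
def mu (w : List Bool) : List Bool := (w.map (fun b => [b, !b])).flatten

/-- The set S = {ε, 0, 1, 00, 11}. -/
def S : Set (List Bool) := {[], [false], [true], [false, false], [true, true]}

/-- A finite word `u` is a prefix of the infinite word `w`. -/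
def PrefixSeq {α : Type*} (u : List α) (w : ℕ → α) : Prop :=
  ∀ (j : ℕ) (h : j < u.length), u.get ⟨j, h⟩ = w j

/-- A finite word `u` is a factor of the infinite word `w`. -/
def IsFactorSeq (u : List Bool) (w : ℕ → Bool) : Prop :=
  ∃ i : ℕ, ∀ (j : ℕ) (h : j < u.length), u.get ⟨j, h⟩ = w (i + j)

/-- The finite word `u` has period `p` (with `1 ≤ p ≤ |u|`):
`u[i] = u[i+p]` for all `0 ≤ i < |u| - p`. -/
def HasPeriod (u : List Bool) (p : ℕ) : Prop :=
  1 ≤ p ∧ p ≤ u.length ∧ ∀ i, i + p < u.length → u.getD i false = u.getD (i + p) false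

/-- The least period of a finite word. -/
noncomputable def leastPeriod (u : List Bool) : ℕ := sInf {p | HasPeriod u p}

/-- The exponent of a nonempty finite word: its length divided by its least period. -/
noncomputable def exponent (u : List Bool) : ℚ := (u.length : ℚ) / (leastPeriod u : ℚ)

/-- A finite word avoids α-powers: no nonempty factor has exponent ≥ α. -/
def AvoidsPow (a : ℚ) (w : List Bool) : Prop :=
  ∀ u : List Bool, u ≠ [] → u <:+: w → exponent u < a

/-- A finite word avoids α⁺-powers: no nonempty factor has exponent > α. -/
def AvoidsPowPlus (a : ℚ) (w : List Bool) : Prop :=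
  ∀ u : List Bool, u ≠ [] → u <:+: w → exponent u ≤ a

/-- An infinite word avoids α-powers. -/
def AvoidsPowSeq (a : ℚ) (w : ℕ → Bool) : Prop :=
  ∀ u : List Bool, u ≠ [] → IsFactorSeq u w → exponent u < a

/-- An infinite word avoids α⁺-powers. -/
def AvoidsPowPlusSeq (a : ℚ) (w : ℕ → Bool) : Prop :=
  ∀ u : List Bool, u ≠ [] → IsFactorSeq u w → exponent u ≤ a

/-- An overlap is a word of the form a x a x a, with a a single letter. -/
def IsOverlap (u : List Bool) : Prop :=
  ∃ (a : Bool) (x : List Bool), u = [a] ++ x ++ [a] ++ x ++ [a]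

/-- Overlap-freeness for finite words. -/
def OverlapFree (w : List Bool) : Prop := ∀ u : List Bool, u <:+: w → ¬ IsOverlap u

/-- Overlap-freeness for infinite words. -/
def OverlapFreeSeq (w : ℕ → Bool) : Prop := ∀ u : List Bool, IsFactorSeq u w → ¬ IsOverlap u

/-- The Thue–Morse word t = 0110100110010110⋯ : t[n] = 1 iff the number of
ones in the binary expansion of n is odd. -/
def thueMorse : ℕ → Bool := fun n => (Nat.digits 2 n).count 1 % 2 == 1

/-- The complement t̄ of the Thue–Morse word. -/
def tmbar : ℕ → Bool := fun n => ! thueMorse n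

/-- The infinite word obtained by prepending the finite word `u` to `w`. -/
def appendSeq (u : List Bool) (w : ℕ → Bool) : ℕ → Bool :=
  fun n => if h : n < u.length then u.get ⟨n, h⟩ else w (n - u.length)

/-- Lexicographic order on infinite binary words (with 0 < 1). -/
def seqLE (v w : ℕ → Bool) : Prop :=
  v = w ∨ ∃ n : ℕ, (∀ i < n, v i = w i) ∧ v n = false ∧ w n = true

/-- The word x₀ μ(x₁) μ²(x₂) ⋯ μ^{n-1}(x_{n-1}). -/
def restivoJoin (x : ℕ → List Bool) (n : ℕ) : List Bool :=
  ((List.range n).map (fun i => mu^[i] (x i))).flatten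

/-- Finite Restivo words: x₀ μ(x₁) ⋯ μ^t(x_t) with all xᵢ ∈ S. -/
def IsRestivo (w : List Bool) : Prop :=
  ∃ (t : ℕ) (x : ℕ → List Bool), (∀ i ≤ t, x i ∈ S) ∧ w = restivoJoin x (t + 1)

/-- Infinite Restivo words: x₀ μ(x₁) μ²(x₂) ⋯ with all xᵢ ∈ S and
infinitely many xᵢ nonempty. -/
def IsRestivoSeq (w : ℕ → Bool) : Prop :=
  ∃ x : ℕ → List Bool, (∀ i, x i ∈ S) ∧ (∀ N : ℕ, ∃ i ≥ N, x i ≠ []) ∧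
    ∀ n : ℕ, PrefixSeq (restivoJoin x n) w

/-- The first `L` letters of `f` contain a fourth power of period `p` starting at position `s`. -/
def HasFourthPower (f : ℕ → Bool) (L s p : ℕ) : Prop :=
  1 ≤ p ∧ s + 4 * p ≤ L ∧ ∀ i < 3 * p, f (s + i) = f (s + i + p)

theorem mu_cons (a : Bool) (w : List Bool) : mu (a :: w) = a :: (!a) :: mu w := by
  simp [mu]

theorem mu_append (u v : List Bool) : mu (u ++ v) = mu u ++ mu v := by
  simp [mu]

theorem mu_flatten (l : List (List Bool)) : mu l.flatten = (l.map mu).flatten := by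
  induction l with
  | nil => simp [mu]
  | cons a l ih => simp [mu_append, ih]

theorem length_mu (w : List Bool) : (mu w).length = 2 * w.length := by
  induction w with
  | nil => simp [mu]
  | cons a w ih => rw [mu_cons]; simp [ih]; ring

theorem getD_mu (w : List Bool) (i : ℕ) (hi : i < w.length) :
    (mu w).getD (2 * i) false = w.getD i false ∧
      (mu w).getD (2 * i + 1) false = !w.getD i false := by
  induction w generalizing i with
  | nil => simp at hi
  | cons a w ih =>
    rw [mu_cons]
    cases i with
    | zero => simp
    | succ i =>
      have h := ih i (by simpa using hi)
      simpa [Nat.mul_add] using h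

theorem restivoJoin_succ (x : ℕ → List Bool) (n : ℕ) :
    restivoJoin x (n + 1) = x 0 ++ mu (restivoJoin (fun i => x (i + 1)) n) := by
  simp only [restivoJoin, List.range_succ_eq_map, mu_flatten, List.map_cons, List.map_map,
    List.flatten_cons, Function.iterate_zero, id]
  congr 3
  funext i
  simp only [Function.comp_apply, Nat.succ_eq_add_one, Function.iterate_succ_apply']

theorem restivoJoin_succ' (x : ℕ → List Bool) (n : ℕ) :
    restivoJoin x (n + 1) = restivoJoin x n ++ mu^[n] (x n) := by
  simp [restivoJoin, List.range_succ]

/-- A sequence in which every pair of adjacent letters starting at an even offset from `k ≤ 2`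
is `01` or `10` contains no fourth power of odd period. -/
theorem not_hasFourthPower_of_odd {g : ℕ → Bool} {k L s p : ℕ} (hk : k ≤ 2)
    (hg : ∀ i < L, g (k + 2 * i + 1) = !g (k + 2 * i)) (hp : p % 2 = 1) :
    ¬ HasFourthPower g (k + 2 * L) s p := by
  rintro ⟨-, hL, h⟩
  have aligned : ∀ n, k ≤ n → n % 2 = k % 2 → n + 1 < s + 4 * p → g (n + 1) = !g n := by
    intro n hn hpar hlt
    have := hg ((n - k) / 2) (by omega)
    rwa [show k + 2 * ((n - k) / 2) = n by omega] at this
  have period : ∀ n, s ≤ n → n < s + 3 * p → g n = g (n + p) := by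
    intro n hn hlt
    have := h (n - s) (by omega)
    rwa [show s + (n - s) = n by omega] at this
  by_cases hp1 : p = 1
  · subst hp1
    obtain ⟨n, hn, hkn, hpar, hlt⟩ :
        ∃ n, s ≤ n ∧ k ≤ n ∧ n % 2 = k % 2 ∧ n + 1 < s + 4 := by
      by_cases hs : s % 2 = k % 2
      · exact ⟨s + 2, by omega, by omega, by omega, by omega⟩
      · exact ⟨s + 1, by omega, by omega, by omega, by omega⟩
    have h1 := aligned n hkn hpar (by omega)
    have h2 := period n hn (by omega)
    simp [h1] at h2
  · obtain ⟨t, hst, hkt, hts⟩ : ∃ t, s ≤ t ∧ k ≤ t ∧ t ≤ s + 2 :=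
      ⟨max s k, by omega, by omega, by omega⟩
    have alternating : ∀ i < p, g (t + i + 1) = !g (t + i) := by
      intro i hi
      by_cases hpar : (t + i) % 2 = k % 2
      · exact aligned _ (by omega) hpar (by omega)
      · have h1 := aligned (t + i + p) (by omega) (by omega) (by omega)
        have h2 := period (t + i) (by omega) (by omega)
        have h3 := period (t + i + 1) (by omega) (by omega)
        rw [h2, h3, ← h1]
        congr 1
        omega
    have parity : ∀ i ≤ p, g (t + i) = (g t ^^ decide (i % 2 = 1)) := by
      intro i
      induction i with
      | zero => simp
      | succ i ih =>
        intro hi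
        rw [← add_assoc, alternating i (by omega), ih (by omega)]
        rcases Nat.mod_two_eq_zero_or_one i with hi2 | hi2 <;>
          simp [Nat.add_mod, hi2]
    have h1 := parity p le_rfl
    have h2 := period t hst (by omega)
    rw [← h2] at h1
    simp [hp] at h1

theorem hasFourthPower_desubstitute {f g : ℕ → Bool} {k L s p : ℕ} (hk : k ≤ 2)
    (hk2 : k = 2 → g 0 = g 1) (hg0 : ∀ i < L, g (k + 2 * i) = f i)
    (hg1 : ∀ i < L, g (k + 2 * i + 1) = !f i) (h : HasFourthPower g (k + 2 * L) s p) :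
    ∃ s' p', HasFourthPower f L s' p' := by
  rcases Nat.mod_two_eq_zero_or_one p with hp | hp
  · obtain ⟨q, rfl⟩ : ∃ q, p = 2 * q := ⟨p / 2, by omega⟩
    obtain ⟨hp1, hL, h⟩ := h
    by_cases hks : k ≤ s
    · rcases Nat.mod_two_eq_zero_or_one (s - k) with hs | hs
      · obtain ⟨j, rfl⟩ : ∃ j, s = k + 2 * j := ⟨(s - k) / 2, by omega⟩
        refine ⟨j, q, by omega, by omega, fun i hi => ?_⟩
        rw [← hg0 _ (by omega), ← hg0 _ (by omega)]
        convert h (2 * i) (by omega) using 2 <;> ring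
      · obtain ⟨j, rfl⟩ : ∃ j, s = k + 2 * j + 1 := ⟨(s - k) / 2, by omega⟩
        refine ⟨j, q, by omega, by omega, fun i hi => ?_⟩
        rw [← Bool.not_inj_iff, ← hg1 _ (by omega), ← hg1 _ (by omega)]
        convert h (2 * i) (by omega) using 2 <;> ring
    · by_cases hs : k = s + 1
      · subst hs
        refine ⟨0, q, by omega, by omega, fun i hi => ?_⟩
        rw [← hg0 _ (by omega), ← hg0 _ (by omega)]
        convert h (2 * i + 1) (by omega) using 2 <;> ring
      · obtain ⟨rfl, rfl⟩ : k = 2 ∧ s = 0 := by omega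
        have e0 := h 0 (by omega)
        have e1 := h 1 (by omega)
        have b0 := hg0 (q - 1) (by omega)
        have b1 := hg1 (q - 1) (by omega)
        rw [show 2 + 2 * (q - 1) = 2 * q by omega] at b0 b1
        rw [zero_add, zero_add, b0] at e0
        rw [zero_add, add_comm 1 (2 * q), b1, ← hk2 rfl, e0] at e1
        simp at e1
  · exact absurd h (not_hasFourthPower_of_odd hk (fun i hi => by rw [hg1 i hi, hg0 i hi]) hp)

theorem not_hasFourthPower_restivoJoin (n : ℕ) (x : ℕ → List Bool) (hx : ∀ i < n, x i ∈ S)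
    (s p : ℕ) :
    ¬ HasFourthPower (fun i => (restivoJoin x n).getD i false) (restivoJoin x n).length s p := by
  induction n generalizing x s p with
  | zero =>
    rintro ⟨h1, h2, -⟩
    simp [restivoJoin] at h2
    omega
  | succ n ih =>
    intro h
    have hx0 : x 0 = [] ∨ x 0 = [false] ∨ x 0 = [true] ∨ x 0 = [false, false] ∨
        x 0 = [true, true] := by simpa [S] using hx 0 (by omega)
    rw [restivoJoin_succ] at h
    rw [List.length_append, length_mu] at h
    obtain ⟨s', p', h'⟩ := hasFourthPower_desubstitute
      (f := fun i => (restivoJoin (fun i => x (i + 1)) n).getD i false)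
      (by rcases hx0 with h | h | h | h | h <;> simp [h])
      (by rcases hx0 with h | h | h | h | h <;> simp [h])
      (fun i hi => by
        rw [List.getD_append_right _ _ _ _ (by omega), Nat.add_sub_cancel_left]
        exact (getD_mu _ i hi).1)
      (fun i hi => by
        rw [List.getD_append_right _ _ _ _ (by omega), add_assoc, Nat.add_sub_cancel_left]
        exact (getD_mu _ i hi).2) h
    exact ih _ (fun i hi => hx _ (by omega)) s' p' h'

theorem hasPeriod_leastPeriod {u : List Bool} (hu : u ≠ []) : HasPeriod u (leastPeriod u) :=
  Nat.sInf_mem (s := {p | HasPeriod u p})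
    ⟨u.length, List.length_pos_iff.2 hu, le_rfl, fun i hi => by omega⟩

theorem HasPeriod.hasFourthPower {u : List Bool} {p : ℕ} (h : HasPeriod u p)
    (hlen : 4 * p ≤ u.length) : HasFourthPower (fun i => u.getD i false) u.length 0 p := by
  refine ⟨h.1, by omega, fun i hi => ?_⟩
  simpa using h.2.2 i (by omega)

theorem hasFourthPower_of_le_exponent {u : List Bool} (hu : u ≠ []) (h : 4 ≤ exponent u) :
    HasFourthPower (fun i => u.getD i false) u.length 0 (leastPeriod u) := by
  have hp := hasPeriod_leastPeriod hu
  refine hp.hasFourthPower ?_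
  have hpos : (0 : ℚ) < leastPeriod u := by exact_mod_cast hp.1
  rw [exponent, le_div_iff₀ hpos] at h
  exact_mod_cast h

theorem hasFourthPower_append {u : List Bool} (hu : u ≠ []) :
    HasFourthPower (fun i => (u ++ u ++ u ++ u).getD i false) (u ++ u ++ u ++ u).length 0
      u.length := by
  have hpos := List.length_pos_iff.2 hu
  refine HasPeriod.hasFourthPower
    ⟨hpos, by simp only [List.length_append]; omega, fun i hi => ?_⟩
    (by simp only [List.length_append]; omega)
  simp only [List.length_append] at hi
  rw [List.getD_append _ _ _ _ (by simp only [List.length_append]; omega)]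
  rw [show u ++ u ++ u ++ u = u ++ (u ++ u ++ u) by simp,
    List.getD_append_right u _ _ _ (by omega), Nat.add_sub_cancel]

theorem HasFourthPower.of_eq_shift {f g : ℕ → Bool} {L M s p a : ℕ} (h : HasFourthPower f L s p)
    (hM : a + L ≤ M) (hfg : ∀ i < L, f i = g (a + i)) : HasFourthPower g M (a + s) p := by
  obtain ⟨h1, h2, h3⟩ := h
  refine ⟨h1, by omega, fun i hi => ?_⟩
  rw [add_assoc a s i, add_assoc a (s + i) p, ← hfg _ (by omega), ← hfg _ (by omega), h3 i hi]

theorem HasFourthPower.of_infix {u w : List Bool} {s p : ℕ} (huw : u <:+: w)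
    (h : HasFourthPower (fun i => u.getD i false) u.length s p) :
    ∃ s', HasFourthPower (fun i => w.getD i false) w.length s' p := by
  obtain ⟨a, b, rfl⟩ := huw
  refine ⟨_, h.of_eq_shift (a := a.length) (by simp only [List.length_append]; omega)
    fun i hi => ?_⟩
  rw [List.append_assoc, List.getD_append_right _ _ _ _ (by omega), Nat.add_sub_cancel_left,
    List.getD_append _ _ _ _ hi]

theorem length_iterate_mu (n : ℕ) (w : List Bool) : (mu^[n] w).length = 2 ^ n * w.length := by
  induction n with
  | zero => simp
  | succ n ih => rw [Function.iterate_succ_apply', length_mu, ih]; ring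

theorem exists_le_length_restivoJoin {x : ℕ → List Bool} (hx : ∀ N : ℕ, ∃ i ≥ N, x i ≠ [])
    (L : ℕ) : ∃ n, L ≤ (restivoJoin x n).length := by
  obtain ⟨i, hi, hne⟩ := hx L
  refine ⟨i + 1, ?_⟩
  rw [restivoJoin_succ', List.length_append, length_iterate_mu]
  have h1 := List.length_pos_iff.2 hne
  have h2 := Nat.lt_two_pow_self (n := i)
  nlinarith

theorem not_hasFourthPower_of_isFactorSeq {x : ℕ → List Bool} {w : ℕ → Bool} {u : List Bool}
    (hxS : ∀ i, x i ∈ S) (hx : ∀ N : ℕ, ∃ i ≥ N, x i ≠ [])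
    (hw : ∀ n : ℕ, PrefixSeq (restivoJoin x n) w) (hu : IsFactorSeq u w) (s p : ℕ) :
    ¬ HasFourthPower (fun i => u.getD i false) u.length s p := by
  intro h
  obtain ⟨a, ha⟩ := hu
  obtain ⟨n, hn⟩ := exists_le_length_restivoJoin hx (a + u.length)
  refine not_hasFourthPower_restivoJoin n x (fun i _ => hxS i) _ _
    (h.of_eq_shift hn fun i hi => ?_)
  have h1 := ha i hi
  have h2 := hw n (a + i) (by omega)
  simp only [List.get_eq_getElem] at h1 h2
  rw [List.getD_eq_getElem _ _ hi, List.getD_eq_getElem _ _ (by omega), h1, h2]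

/-- Every finite or infinite Restivo word avoids 4-powers: it has no nonempty
factor of exponent ≥ 4, equivalently no factor uuuu with u nonempty. -/
theorem restivo_fourthPowerFree :
    (∀ w : List Bool, IsRestivo w → AvoidsPow 4 w ∧
      ∀ u : List Bool, u ≠ [] → ¬ (u ++ u ++ u ++ u) <:+: w) ∧
    (∀ w : ℕ → Bool, IsRestivoSeq w → AvoidsPowSeq 4 w ∧
      ∀ u : List Bool, u ≠ [] → ¬ IsFactorSeq (u ++ u ++ u ++ u) w) := by
  constructor
  · rintro w ⟨t, x, hx, rfl⟩
    have key := not_hasFourthPower_restivoJoin (t + 1) x fun i hi => hx i (by omega)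
    refine ⟨fun u hu huw => not_le.1 fun h => ?_, fun u hu huw => ?_⟩
    · obtain ⟨s, hs⟩ := (hasFourthPower_of_le_exponent hu h).of_infix huw
      exact key _ _ hs
    · obtain ⟨s, hs⟩ := (hasFourthPower_append hu).of_infix huw
      exact key _ _ hs
  · rintro w ⟨x, hxS, hx, hw⟩
    exact ⟨fun u hu huw => not_le.1 fun h =>
        not_hasFourthPower_of_isFactorSeq hxS hx hw huw _ _ (hasFourthPower_of_le_exponent hu h),
      fun u hu huw =>
        not_hasFourthPower_of_isFactorSeq hxS hx hw huw _ _ (hasFourthPower_append hu)⟩
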